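/- Consider a single access by a minimally self-adjusting BST algorithm to element s in tree T with search path P, producing tree T'. Suppose P is partitioned into subtree-disjoint sets D_1,…,D_k and monotone sets M_1,…,M_ℓ. Then for every positive weight function w: Σ_{i=1}^{k} |D_i| ≤ Φ_T(P) − Φ_{T'}(P) + 2k + (8k+ℓ)·log(W/w(s)). -/

import Mathlib

namespace Paper

inductive BTree where
  | nil : BTree
  | node : BTree → ℕ → BTree → BTree
deriving DecidableEq

namespace BTree

def keys : BTree → Finset ℕ
  | nil => ∅
  | node l x r => insert x (keys l ∪ keys r)

def root? : BTree → Option ℕ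
  | nil => none
  | node _ x _ => some x

def isBST : BTree → Prop
  | nil => True
  | node l x r => (∀ y ∈ keys l, y < x) ∧ (∀ y ∈ keys r, x < y) ∧ isBST l ∧ isBST r

def subtree? (s : ℕ) : BTree → Option BTree
  | nil => none
  | node l x r => if s = x then some (node l x r) else if s < x then subtree? s l else subtree? s r

/-- The set of keys of the subtree rooted at `s` (∅ if `s` is not in the tree). -/
def subtreeKeys (T : BTree) (s : ℕ) : Finset ℕ := ((subtree? s T).map keys).getD ∅

/-- The search path to `s`, listed from the root downwards. -/
def pathList (s : ℕ) : BTree → List ℕ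
  | nil => []
  | node l x r => if s = x then [x] else if s < x then x :: pathList s l else x :: pathList s r

def pathSet (T : BTree) (s : ℕ) : Finset ℕ := (pathList s T).toFinset

def nodeDepth (s : ℕ) : BTree → ℕ
  | nil => 0
  | node l x r => if s = x then 0 else if s < x then nodeDepth s l + 1 else nodeDepth s r + 1

/-- Number of right-going edges on the path from the root to `s`. -/
def rightDepth (s : ℕ) : BTree → ℕ
  | nil => 0
  | node l x r => if s = x then 0 else if s < x then rightDepth s l else rightDepth s r + 1

/-- Number of left-going edges on the path from the root to `s`. -/
def leftDepth (s : ℕ) : BTree → ℕ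
  | nil => 0
  | node l x r => if s = x then 0 else if s < x then leftDepth s l + 1 else leftDepth s r

def leafCount : BTree → ℕ
  | nil => 0
  | node nil _ nil => 1
  | node l _ r => leafCount l + leafCount r

/-- The wing partition of a BST, each wing listed from its topmost node downwards. -/
def wings : BTree → List (List ℕ)
  | nil => []
  | node l x r =>
    match wings l with
    | [] => [x] :: wings r
    | wl :: rest => (x :: wl) :: (rest ++ wings r)

end BTree

open BTree

/-- The left-leaning path on `[n]`: `n` at the root, `1` at the deepest node. -/
def leftPathTree : ℕ → BTree
  | 0 => BTree.nil
  | n + 1 => BTree.node (leftPathTree n) (n + 1) BTree.nil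

/-- Number of side alternations (w.r.t. `s`) between adjacent elements of a list. -/
def sideAlt (s : ℕ) : List ℕ → ℕ
  | x :: y :: rest => (if (x < s ∧ s < y) ∨ (y < s ∧ s < x) then 1 else 0) + sideAlt s (y :: rest)
  | _ => 0

/-- The set of elements involved in side alternations (w.r.t. `s`) in a list. -/
def zigzagSet (s : ℕ) : List ℕ → Finset ℕ
  | x :: y :: rest =>
    (if (x < s ∧ s < y) ∨ (y < s ∧ s < x) then ({x, y} : Finset ℕ) else ∅) ∪ zigzagSet s (y :: rest)
  | _ => ∅

noncomputable def wsum (w : ℕ → ℝ) (X : Finset ℕ) : ℝ := ∑ b ∈ X, w b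

/-- Partial sum-of-logs potential of the set `X` in tree `T` (binary logarithm). -/
noncomputable def phiOn (w : ℕ → ℝ) (T : BTree) (X : Finset ℕ) : ℝ :=
  ∑ a ∈ X, Real.logb 2 (wsum w (subtreeKeys T a))

noncomputable def phiAll (w : ℕ → ℝ) (T : BTree) : ℝ := phiOn w T (keys T)

/-- A single access of a minimally self-adjusting BST algorithm: the accessed element `s`
becomes the root, the keys are unchanged, and every node off the search path keeps its
subtree; hence the search path is replaced by an after-tree rooted at `s` and the pendent
subtrees are reattached in the unique order-preserving way. -/
structure IsAccess (T : BTree) (s : ℕ) (T' : BTree) : Prop where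
  hT : isBST T
  hT' : isBST T'
  hs : s ∈ keys T
  hkeys : keys T' = keys T
  hroot : root? T' = some s
  hpendent : ∀ a ∈ keys T, a ∉ pathSet T s → subtree? a T' = subtree? a T

/-- The algorithm (viewed as the set of accesses it may perform) satisfies the access lemma
via the sum-of-logs potential. -/
def SatisfiesAL (Alg : BTree → ℕ → BTree → Prop) : Prop :=
  ∃ C : ℝ, 0 ≤ C ∧ ∀ T s T', Alg T s T' → ∀ w : ℕ → ℝ, (∀ i ∈ keys T, 0 < w i) →
    ((pathSet T s).card : ℝ) ≤
      phiAll w T - phiAll w T' + C * (1 + Real.logb 2 (wsum w (keys T) / w s))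

/-- `X` is subtree-disjoint (w.r.t. the tree after the access). -/
def SubtreeDisjoint (T' : BTree) (X : Finset ℕ) : Prop :=
  ∀ a ∈ X, ∀ b ∈ X, a ≠ b → subtreeKeys T' a ∩ subtreeKeys T' b = ∅

/-- `X` is monotone: all elements on one side of `s`, with equal right-depth
(resp. left-depth) in the after-tree.  (For nodes of the search path, depth in the
after-tree coincides with depth in `T'`.) -/
def IsMonotone (s : ℕ) (T' : BTree) (X : Finset ℕ) : Prop :=
  ((∀ x ∈ X, s < x) ∧ ∃ d, ∀ x ∈ X, rightDepth x T' = d) ∨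
  ((∀ x ∈ X, x < s) ∧ ∃ d, ∀ x ∈ X, leftDepth x T' = d)

/-- The after-tree minus its root can be partitioned into (at most) `k` monotone sets. -/
def MonotoneDecomp (T : BTree) (s : ℕ) (T' : BTree) (k : ℕ) : Prop :=
  ∃ M : Fin k → Finset ℕ,
    (∀ i, IsMonotone s T' (M i)) ∧
    (∀ i j, i ≠ j → Disjoint (M i) (M j)) ∧
    Finset.univ.biUnion M = pathSet T s \ {s}

/-- The leaves of the after-tree: path nodes having no path node as proper descendant in `T'`. -/
def afterLeaves (T : BTree) (s : ℕ) (T' : BTree) : Finset ℕ :=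
  (pathSet T s).filter (fun x => subtreeKeys T' x ∩ pathSet T s = {x})

/-- Rotate-to-root: `s` becomes the root and ancestor relations are otherwise preserved,
equivalently `T'(a) = T(a) ∩ (-∞,s)` for path nodes `a < s` and symmetrically for `a > s`. -/
def IsRotateToRoot (T : BTree) (s : ℕ) (T' : BTree) : Prop :=
  subtreeKeys T' s = keys T ∧
  ∀ a ∈ pathSet T s,
    (a < s → subtreeKeys T' a = (subtreeKeys T a).filter (fun b => b < s)) ∧
    (s < a → subtreeKeys T' a = (subtreeKeys T a).filter (fun b => s < b))

def pendTree : Option ℕ → BTree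
  | none => BTree.nil
  | some u => BTree.node BTree.nil u BTree.nil

def buildLeft (l : List (ℕ × Option ℕ)) : BTree :=
  l.foldl (fun t vc => BTree.node (pendTree vc.2) vc.1 t) BTree.nil

def buildRight (l : List (ℕ × Option ℕ)) : BTree :=
  l.foldl (fun t vc => BTree.node t vc.1 (pendTree vc.2)) BTree.nil

/-- Global view of splay: process the reversed search path `v₁, v₂, …` in pairs; if a pair
lies on the same side of `s`, the more ancestral element is removed from its path and
becomes a (pendant) child of the other.  Returns the two spines (elements `< s` and `> s`),
deepest first, each spine node with its optional pendant child. -/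
def splaySpines (s : ℕ) : List ℕ → List (ℕ × Option ℕ) × List (ℕ × Option ℕ)
  | [] => ([], [])
  | [v] => if v < s then ([(v, none)], []) else ([], [(v, none)])
  | v :: u :: rest =>
    let p := splaySpines s rest
    if v < s then
      if u < s then ((v, some u) :: p.1, p.2)
      else ((v, none) :: p.1, (u, none) :: p.2)
    else
      if u < s then ((u, none) :: p.1, (v, none) :: p.2)
      else (p.1, (v, some u) :: p.2)

/-- The after-tree of a splay access, built from the reversed search path without `s`. -/
def splayAfterTree (s : ℕ) (l : List ℕ) : BTree :=
  BTree.node (buildLeft (splaySpines s l).1) s (buildRight (splaySpines s l).2)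

/-- A splay access: a valid access whose after-tree (the restriction of `T'` to the search
path) is the splay after-tree. -/
def IsSplayAccess (T : BTree) (s : ℕ) (T' : BTree) : Prop :=
  IsAccess T s T' ∧
  ∀ x ∈ pathSet T s,
    subtreeKeys T' x ∩ pathSet T s = subtreeKeys (splayAfterTree s (pathList s T).reverse.tail) x

/-- A path-balance access: a valid access whose after-tree is a balanced BST of depth
`⌈log₂ (1 + |P|)⌉` rooted at `s`. -/
def IsPathBalanceAccess (T : BTree) (s : ℕ) (T' : BTree) : Prop :=
  IsAccess T s T' ∧
  ∀ x ∈ pathSet T s, nodeDepth x T' ≤ Nat.clog 2 (1 + (pathSet T s).card)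

def isParent (Q : BTree) (x y : ℕ) : Prop := pathList y Q = pathList x Q ++ [y]

/-- One step of a decomposition: a (descending) path `Pi` of `Q` is rearranged into a tree,
all other nodes keeping their subtrees. -/
def StepRel (Q Q' : BTree) (Pi : Finset ℕ) : Prop :=
  isBST Q' ∧ keys Q' = keys Q ∧
  (∃ l : List ℕ, l ≠ [] ∧ List.Chain' (isParent Q) l ∧ l.toFinset = Pi) ∧
  (∀ a ∈ keys Q, a ∉ Pi → subtree? a Q' = subtree? a Q)

/-- The transformation of the before-path `P0` (as a tree) into the after-tree `A` admits a
local decomposition with window size `wdw`. -/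
def HasLocalDecomp (s : ℕ) (P0 A : BTree) (wdw : ℕ) : Prop :=
  ∃ (k : ℕ) (Q : ℕ → BTree) (Ps : ℕ → Finset ℕ),
    1 ≤ k ∧ Q 0 = P0 ∧ Q k = A ∧
    (∀ i < k, StepRel (Q i) (Q (i + 1)) (Ps i)) ∧
    s ∈ Ps 0 ∧
    (∀ i, i + 1 < k → (Ps (i + 1) \ Ps i).Nonempty) ∧
    (∀ i, i + 1 < k → (Ps (i + 1) ∩ Ps i).Nonempty) ∧
    (∀ i j, i + 1 < j → j < k → Disjoint (Ps i \ Ps (i + 1)) (Ps j)) ∧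
    (∀ i < k, (Ps i).card ≤ wdw)

/-- The search path to `s` in `T`, as a tree (the before-path of the transformation). -/
def pathTree (s : ℕ) : BTree → BTree
  | BTree.nil => BTree.nil
  | BTree.node l x r =>
    if s = x then BTree.node BTree.nil x BTree.nil
    else if s < x then BTree.node (pathTree s l) x BTree.nil
    else BTree.node BTree.nil x (pathTree s r)

/-- `A` is the after-tree of the access `(T, s, T')`: the restriction of `T'` to the search path. -/
def IsAfterTree (T : BTree) (s : ℕ) (T' A : BTree) : Prop :=
  isBST A ∧ keys A = pathSet T s ∧
  ∀ x ∈ pathSet T s, subtreeKeys A x = subtreeKeys T' x ∩ pathSet T s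

/-- The algorithm is local with window size `wdw`. -/
def IsLocal (Alg : BTree → ℕ → BTree → Prop) (wdw : ℕ) : Prop :=
  ∀ T s T', Alg T s T' → ∀ A, IsAfterTree T s T' A → HasLocalDecomp s (pathTree s T) A wdw

open scoped Classical in
noncomputable def stair (n : ℕ) (h : ℕ → ℕ) (s : ℕ) : Finset ℕ :=
  (Finset.Icc 1 n).filter
    (fun b => ∀ b' ∈ Finset.Icc 1 n, ((s < b' ∧ b' < b) ∨ (b < b' ∧ b' < s)) → h b' < h b)

open scoped Classical in
noncomputable def nbhd (n : ℕ) (h : ℕ → ℕ) (a : ℕ) : Finset ℕ :=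
  (Finset.Icc 1 n).filter
    (fun b => ∀ b' ∈ Finset.Icc 1 n, b' ≠ a → min a b ≤ b' → b' ≤ max a b → h b' < h a)

/-- Geometric sum-of-logs partial potential. -/
noncomputable def phiGeo (n : ℕ) (h : ℕ → ℕ) (w : ℕ → ℝ) (X : Finset ℕ) : ℝ :=
  ∑ a ∈ X, Real.logb 2 (wsum w (nbhd n h a))

/-- `l` is (the reversal of) a valid search path to `s`, without `s`, deepest element first. -/
def ValidRevPath (s : ℕ) (l : List ℕ) : Prop :=
  l.Nodup ∧ s ∉ l ∧
  l.Pairwise (fun a b => (a < s → b < s → b < a) ∧ (s < a → s < b → a < b))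

end Paper

open Paper Paper.BTree

namespace Paper

namespace BTree

lemma subtreeKeys_nil (a : ℕ) : subtreeKeys nil a = ∅ := rfl

lemma subtreeKeys_node (l r : BTree) (x a : ℕ) :
    subtreeKeys (node l x r) a =
      if a = x then insert x (keys l ∪ keys r)
      else if a < x then subtreeKeys l a else subtreeKeys r a := by
  unfold subtreeKeys
  rw [subtree?]
  split_ifs <;> simp [keys]

lemma subtreeKeys_subset (T : BTree) (a : ℕ) : subtreeKeys T a ⊆ keys T := by
  induction T with
  | nil => simp [subtreeKeys_nil]
  | node l x r ihl ihr =>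
    rw [subtreeKeys_node, keys]
    split_ifs
    · exact Finset.Subset.refl _
    · exact ihl.trans (Finset.subset_union_left.trans (Finset.subset_insert _ _))
    · exact ihr.trans (Finset.subset_union_right.trans (Finset.subset_insert _ _))

lemma mem_subtreeKeys_self {T : BTree} (hT : isBST T) {a : ℕ} (ha : a ∈ keys T) :
    a ∈ subtreeKeys T a := by
  induction T with
  | nil => simp [keys] at ha
  | node l x r ihl ihr =>
    obtain ⟨hl, hr, hbl, hbr⟩ := hT
    rw [subtreeKeys_node]
    simp only [keys, Finset.mem_insert, Finset.mem_union] at ha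
    split_ifs with h1 h2
    · simp [h1]
    · refine ihl hbl ?_
      rcases ha with ha | ha | ha
      · exact absurd ha h1
      · exact ha
      · have := hr a ha; omega
    · refine ihr hbr ?_
      rcases ha with ha | ha | ha
      · exact absurd ha h1
      · have := hl a ha; omega
      · exact ha

/-- The keys of a subtree form an interval of the keys of the whole tree. -/
lemma mem_subtreeKeys_of_between {T : BTree} (hT : isBST T) {a x y z : ℕ}
    (hx : x ∈ subtreeKeys T a) (hy : y ∈ subtreeKeys T a) (hz : z ∈ keys T)
    (hxz : x ≤ z) (hzy : z ≤ y) : z ∈ subtreeKeys T a := by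
  induction T with
  | nil => simp [keys] at hz
  | node l k r ihl ihr =>
    obtain ⟨hl, hr, hbl, hbr⟩ := hT
    rw [subtreeKeys_node] at hx hy ⊢
    simp only [keys, Finset.mem_insert, Finset.mem_union] at hz
    split_ifs at hx hy ⊢ with h1 h2
    · simpa using hz
    · refine ihl hbl hx hy ?_
      have := hl y (subtreeKeys_subset _ _ hy)
      rcases hz with hz | hz | hz
      · omega
      · exact hz
      · have := hr z hz; omega
    · refine ihr hbr hx hy ?_
      have := hr x (subtreeKeys_subset _ _ hx)
      rcases hz with hz | hz | hz
      · omega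
      · have := hl z hz; omega
      · exact hz

lemma pathSet_node (l r : BTree) (x s : ℕ) :
    pathSet (node l x r) s =
      if s = x then {x} else if s < x then insert x (pathSet l s) else insert x (pathSet r s) := by
  unfold pathSet
  rw [pathList]
  split_ifs <;> simp

lemma pathSet_subset_keys (T : BTree) (s : ℕ) : pathSet T s ⊆ keys T := by
  induction T with
  | nil => simp [pathSet, pathList]
  | node l x r ihl ihr =>
    rw [pathSet_node, keys]
    intro a ha
    split_ifs at ha <;> simp only [Finset.mem_insert, Finset.mem_singleton] at ha <;>
      simp only [Finset.mem_insert, Finset.mem_union] <;> grind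

/-- Every node on the search path to `s` has `s` in its subtree. -/
lemma mem_subtreeKeys_of_mem_pathSet {T : BTree} (hT : isBST T) {s a : ℕ} (hs : s ∈ keys T)
    (ha : a ∈ pathSet T s) : s ∈ subtreeKeys T a := by
  induction T with
  | nil => simp [keys] at hs
  | node l x r ihl ihr =>
    obtain ⟨hl, hr, hbl, hbr⟩ := hT
    rw [subtreeKeys_node]
    rw [pathSet_node] at ha
    simp only [keys, Finset.mem_insert, Finset.mem_union] at hs
    by_cases hax : a = x
    · simpa [hax] using hs
    rw [if_neg hax]
    split_ifs at ha with h1 h2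
    · simp at ha; omega
    · have ha' : a ∈ pathSet l s := by simpa [hax] using ha
      rw [if_pos (hl a (pathSet_subset_keys _ _ ha'))]
      refine ihl hbl ?_ ha'
      rcases hs with hs | hs | hs
      · exact absurd hs h1
      · exact hs
      · have := hr s hs; omega
    · have ha' : a ∈ pathSet r s := by simpa [hax] using ha
      have := hr a (pathSet_subset_keys _ _ ha')
      rw [if_neg (by omega)]
      refine ihr hbr ?_ ha'
      rcases hs with hs | hs | hs
      · exact absurd hs h1
      · have := hl s hs; omega
      · exact hs

lemma rightDepth_lt_of_mem_subtreeKeys {T : BTree} (hT : isBST T) {a b : ℕ}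
    (hb : b ∈ subtreeKeys T a) (hab : a < b) : rightDepth a T < rightDepth b T := by
  induction T with
  | nil => simp [subtreeKeys_nil] at hb
  | node l x r ihl ihr =>
    obtain ⟨hl, hr, hbl, hbr⟩ := hT
    rw [subtreeKeys_node] at hb
    split_ifs at hb with h1 h2
    · subst h1
      simp only [rightDepth, if_true]
      rw [if_neg (by omega), if_neg (by omega)]
      omega
    · have hbx := hl b (subtreeKeys_subset _ _ hb)
      simp only [rightDepth]
      rw [if_neg h1, if_pos h2, if_neg hbx.ne, if_pos hbx]
      exact ihl hbl hb
    · simp only [rightDepth]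
      rw [if_neg h1, if_neg h2, if_neg (by omega), if_neg (by omega)]
      exact Nat.succ_lt_succ (ihr hbr hb)

lemma leftDepth_lt_of_mem_subtreeKeys {T : BTree} (hT : isBST T) {a b : ℕ}
    (hb : b ∈ subtreeKeys T a) (hba : b < a) : leftDepth a T < leftDepth b T := by
  induction T with
  | nil => simp [subtreeKeys_nil] at hb
  | node l x r ihl ihr =>
    obtain ⟨hl, hr, hbl, hbr⟩ := hT
    rw [subtreeKeys_node] at hb
    split_ifs at hb with h1 h2
    · subst h1
      simp only [leftDepth, if_true]
      rw [if_neg (by omega), if_pos hba]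
      omega
    · simp only [leftDepth]
      rw [if_neg h1, if_pos h2, if_neg (by omega), if_pos (by omega)]
      exact Nat.succ_lt_succ (ihl hbl hb)
    · have hbx := hr b (subtreeKeys_subset _ _ hb)
      simp only [leftDepth]
      rw [if_neg h1, if_neg h2, if_neg (by omega), if_neg (by omega)]
      exact ihr hbr hb

lemma subtreeKeys_of_root? {T : BTree} {s : ℕ} (h : root? T = some s) :
    subtreeKeys T s = keys T := by
  cases T with
  | nil => simp [root?] at h
  | node l x r =>
    simp only [root?, Option.some.injEq] at h
    rw [subtreeKeys_node, if_pos h.symm, keys]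

lemma lt_of_mem_subtreeKeys_of_root_lt {T : BTree} (hT : isBST T) {s a b : ℕ}
    (h : root? T = some s) (hsa : s < a) (hb : b ∈ subtreeKeys T a) : s < b := by
  cases T with
  | nil => simp [root?] at h
  | node l x r =>
    simp only [root?, Option.some.injEq] at h
    subst h
    rw [subtreeKeys_node, if_neg (by omega), if_neg (by omega)] at hb
    exact hT.2.1 b (subtreeKeys_subset _ _ hb)

lemma lt_of_mem_subtreeKeys_of_lt_root {T : BTree} (hT : isBST T) {s a b : ℕ}
    (h : root? T = some s) (has : a < s) (hb : b ∈ subtreeKeys T a) : b < s := by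
  cases T with
  | nil => simp [root?] at h
  | node l x r =>
    simp only [root?, Option.some.injEq] at h
    subst h
    rw [subtreeKeys_node, if_neg (by omega), if_pos has] at hb
    exact hT.1 b (subtreeKeys_subset _ _ hb)

end BTree

open BTree

lemma one_add_logb_add_logb_le {x S : ℝ} (hx : 0 < x) (hS : 0 < S) :
    1 + Real.logb 2 x + Real.logb 2 S ≤ 2 * Real.logb 2 (S + x) := by
  have h : (1 : ℝ) = Real.logb 2 2 := by simp
  have h2 : 2 * Real.logb 2 (S + x) = Real.logb 2 ((S + x) ^ 2) := by
    rw [Real.logb_pow]; norm_num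
  rw [h2, h, ← Real.logb_mul two_ne_zero hx.ne', ← Real.logb_mul (by positivity) hS.ne']
  exact Real.logb_le_logb_of_le one_lt_two (by positivity) (by nlinarith)

lemma card_add_sum_logb_le {α : Type*} [LinearOrder α] {f g : α → ℝ} {c : ℝ} (hc : 0 < c)
    (X : Finset α) (hg : ∀ a ∈ X, 0 < g a)
    (hf : ∀ a ∈ X, c + ∑ b ∈ X with b < a, g b ≤ f a) :
    (X.card : ℝ) + ∑ a ∈ X, Real.logb 2 (g a) ≤
      ∑ a ∈ X, Real.logb 2 (f a) + 2 * (Real.logb 2 (c + ∑ a ∈ X, g a) - Real.logb 2 c) := by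
  induction X using Finset.induction_on_max with
  | empty => simp
  | insert m X hm ih =>
    have hmX : m ∉ X := fun h => lt_irrefl _ (hm m h)
    have hfilter : ∀ a ∈ X, (insert m X).filter (· < a) = X.filter (· < a) := fun a ha => by
      rw [Finset.filter_insert, if_neg (hm a ha).not_gt]
    have hfilter_m : (insert m X).filter (· < m) = X := by
      rw [Finset.filter_insert, if_neg (lt_irrefl m), Finset.filter_true_of_mem hm]
    have ih' := ih (fun a ha => hg a (Finset.mem_insert_of_mem ha)) (fun a ha => by
      have := hf a (Finset.mem_insert_of_mem ha)
      rwa [hfilter a ha] at this)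
    have hfm := hf m (Finset.mem_insert_self _ _)
    rw [hfilter_m] at hfm
    have hS : 0 < c + ∑ a ∈ X, g a :=
      add_pos_of_pos_of_nonneg hc
        (Finset.sum_nonneg fun a ha => (hg a (Finset.mem_insert_of_mem ha)).le)
    have hstep := one_add_logb_add_logb_le (hg m (Finset.mem_insert_self _ _)) hS
    have hlog := Real.logb_le_logb_of_le one_lt_two hS hfm
    rw [Finset.card_insert_of_notMem hmX, Finset.sum_insert hmX, Finset.sum_insert hmX,
      Finset.sum_insert hmX, add_comm (g m)]
    rw [add_assoc c] at hstep
    push_cast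
    linarith

lemma sum_logb_le_of_shift {α : Type*} [LinearOrder α] {f g : α → ℝ} {c C : ℝ} (hc : 0 < c)
    (hC : c ≤ C) (X : Finset α) (hg : ∀ a ∈ X, 0 < g a) (hgC : ∀ a ∈ X, g a ≤ C)
    (hcf : ∀ a ∈ X, c ≤ f a) (hgf : ∀ a ∈ X, ∀ b ∈ X, a < b → g a ≤ f b) :
    ∑ a ∈ X, Real.logb 2 (g a) ≤
      ∑ a ∈ X, Real.logb 2 (f a) + (Real.logb 2 C - Real.logb 2 c) := by
  induction X using Finset.induction_on_max generalizing C with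
  | empty =>
    have := Real.logb_le_logb_of_le one_lt_two hc hC
    simpa using this
  | insert m X hm ih =>
    have hmX : m ∉ X := fun h => lt_irrefl _ (hm m h)
    have hmem := Finset.mem_insert_self m X
    have ih' := ih (hcf m hmem) (fun a ha => hg a (Finset.mem_insert_of_mem ha))
      (fun a ha => hgf a (Finset.mem_insert_of_mem ha) m hmem (hm a ha))
      (fun a ha => hcf a (Finset.mem_insert_of_mem ha))
      (fun a ha b hb => hgf a (Finset.mem_insert_of_mem ha) b (Finset.mem_insert_of_mem hb))
    have hlog := Real.logb_le_logb_of_le one_lt_two (hg m hmem) (hgC m hmem)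
    rw [Finset.sum_insert hmX, Finset.sum_insert hmX]
    linarith

lemma wsum_le_wsum {w : ℕ → ℝ} {X Y : Finset ℕ} (h : X ⊆ Y) (hw : ∀ i ∈ Y, 0 < w i) :
    wsum w X ≤ wsum w Y :=
  Finset.sum_le_sum_of_subset_of_nonneg h fun i hi _ => (hw i hi).le

lemma le_wsum {w : ℕ → ℝ} {X : Finset ℕ} {s : ℕ} (hs : s ∈ X) (hw : ∀ i ∈ X, 0 < w i) :
    w s ≤ wsum w X :=
  Finset.single_le_sum (f := w) (fun i hi => (hw i hi).le) hs

lemma wsum_pos {w : ℕ → ℝ} {X : Finset ℕ} {s : ℕ} (hs : s ∈ X) (hw : ∀ i ∈ X, 0 < w i) :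
    0 < wsum w X :=
  (hw s hs).trans_le (le_wsum hs hw)

/-- The nodes of `X` lie on one side of `s`, away from `s` in the order of `α`; `A` and `B` give
their subtrees before and after the access. -/
lemma card_add_sum_logb_wsum_le {α : Type*} [LinearOrder α] {A B : α → Finset ℕ} {w : ℕ → ℝ}
    {K : Finset ℕ} {s : ℕ} (hw : ∀ i ∈ K, 0 < w i) (hs : s ∈ K) (X : Finset α)
    (hAK : ∀ a ∈ X, A a ⊆ K) (hBK : ∀ a ∈ X, B a ⊆ K) (hsA : ∀ a ∈ X, s ∈ A a)
    (hsB : ∀ a ∈ X, s ∉ B a) (hB : ∀ a ∈ X, (B a).Nonempty)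
    (hdisj : ∀ a ∈ X, ∀ b ∈ X, a ≠ b → Disjoint (B a) (B b))
    (hBA : ∀ a ∈ X, ∀ b ∈ X, a < b → B a ⊆ A b) :
    (X.card : ℝ) + ∑ a ∈ X, Real.logb 2 (wsum w (B a)) ≤
      ∑ a ∈ X, Real.logb 2 (wsum w (A a)) + 2 * Real.logb 2 (wsum w K / w s) := by
  have hunion : ∀ Y ⊆ X, ∀ Z ⊆ K, s ∈ Z → (∀ b ∈ Y, B b ⊆ Z) →
      w s + ∑ b ∈ Y, wsum w (B b) ≤ wsum w Z := by
    intro Y hY Z hZ hsZ hBZ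
    have h1 : ∑ b ∈ Y, wsum w (B b) = wsum w (Y.biUnion B) :=
      (Finset.sum_biUnion fun a ha b hb hab => hdisj a (hY ha) b (hY hb) hab).symm
    have h2 : s ∉ Y.biUnion B := by
      simp only [Finset.mem_biUnion, not_exists, not_and]
      exact fun a ha => hsB a (hY ha)
    have h3 : w s + wsum w (Y.biUnion B) = wsum w (insert s (Y.biUnion B)) :=
      (Finset.sum_insert h2).symm
    rw [h1, h3]
    exact wsum_le_wsum (Finset.insert_subset hsZ (Finset.biUnion_subset.2 hBZ))
      fun i hi => hw i (hZ hi)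
  have hpos : ∀ a ∈ X, 0 < wsum w (B a) := fun a ha =>
    (hB a ha).elim fun b hb => wsum_pos hb fun i hi => hw i (hBK a ha hi)
  have hmain := card_add_sum_logb_le (f := fun a => wsum w (A a)) (hw s hs) X hpos fun a ha =>
    hunion _ (Finset.filter_subset _ _) _ (hAK a ha) (hsA a ha) fun b hb =>
      hBA b (Finset.mem_filter.1 hb).1 a ha (Finset.mem_filter.1 hb).2
  have htot := Real.logb_le_logb_of_le one_lt_two
    (add_pos_of_pos_of_nonneg (hw s hs) (Finset.sum_nonneg fun a ha => (hpos a ha).le))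
    (hunion X (Finset.Subset.refl _) K (Finset.Subset.refl _) hs hBK)
  rw [Real.logb_div (wsum_pos hs hw).ne' (hw s hs).ne']
  linarith

lemma sum_logb_wsum_le {α : Type*} [LinearOrder α] {A B : α → Finset ℕ} {w : ℕ → ℝ}
    {K : Finset ℕ} {s : ℕ} (hw : ∀ i ∈ K, 0 < w i) (hs : s ∈ K) (X : Finset α)
    (hAK : ∀ a ∈ X, A a ⊆ K) (hBK : ∀ a ∈ X, B a ⊆ K) (hsA : ∀ a ∈ X, s ∈ A a)
    (hB : ∀ a ∈ X, (B a).Nonempty) (hBA : ∀ a ∈ X, ∀ b ∈ X, a < b → B a ⊆ A b) :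
    ∑ a ∈ X, Real.logb 2 (wsum w (B a)) ≤
      ∑ a ∈ X, Real.logb 2 (wsum w (A a)) + Real.logb 2 (wsum w K / w s) := by
  rw [Real.logb_div (wsum_pos hs hw).ne' (hw s hs).ne']
  exact sum_logb_le_of_shift (hw s hs) (le_wsum hs hw) X
    (fun a ha => (hB a ha).elim fun b hb => wsum_pos hb fun i hi => hw i (hBK a ha hi))
    (fun a ha => wsum_le_wsum (hBK a ha) hw)
    (fun a ha => le_wsum (hsA a ha) fun i hi => hw i (hAK a ha hi))
    (fun a ha b hb hab => wsum_le_wsum (hBA a ha b hb hab) fun i hi => hw i (hAK b hb hi))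

section Access

variable {T T' : BTree} {s : ℕ}

lemma IsAccess.mem_subtreeKeys_self (h : IsAccess T s T') {a : ℕ} (ha : a ∈ pathSet T s) :
    a ∈ subtreeKeys T' a :=
  BTree.mem_subtreeKeys_self h.hT' (h.hkeys ▸ pathSet_subset_keys _ _ ha)

lemma IsAccess.subtreeKeys_subset (h : IsAccess T s T') (a : ℕ) :
    subtreeKeys T' a ⊆ keys T :=
  h.hkeys ▸ BTree.subtreeKeys_subset T' a

lemma IsAccess.subtreeKeys_subset_of_lt (h : IsAccess T s T') {a b : ℕ} (hsa : s < a)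
    (hab : a < b) (ha : a ∈ pathSet T s) (hb : b ∈ pathSet T s) (hba : b ∉ subtreeKeys T' a) :
    subtreeKeys T' a ⊆ subtreeKeys T b := by
  intro x hx
  have hbT := pathSet_subset_keys _ _ hb
  have hsx := lt_of_mem_subtreeKeys_of_root_lt h.hT' h.hroot hsa hx
  have hxb : x < b := by
    by_contra hxb
    exact hba (mem_subtreeKeys_of_between h.hT' (h.mem_subtreeKeys_self ha) hx
      (h.hkeys ▸ hbT) hab.le (not_lt.1 hxb))
  exact mem_subtreeKeys_of_between h.hT (mem_subtreeKeys_of_mem_pathSet h.hT h.hs hb)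
    (BTree.mem_subtreeKeys_self h.hT hbT) (h.subtreeKeys_subset a hx) hsx.le hxb.le

lemma IsAccess.subtreeKeys_subset_of_gt (h : IsAccess T s T') {a b : ℕ} (has : a < s)
    (hba : b < a) (ha : a ∈ pathSet T s) (hb : b ∈ pathSet T s) (hb' : b ∉ subtreeKeys T' a) :
    subtreeKeys T' a ⊆ subtreeKeys T b := by
  intro x hx
  have hbT := pathSet_subset_keys _ _ hb
  have hxs := lt_of_mem_subtreeKeys_of_lt_root h.hT' h.hroot has hx
  have hbx : b < x := by
    by_contra hbx
    exact hb' (mem_subtreeKeys_of_between h.hT' hx (h.mem_subtreeKeys_self ha)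
      (h.hkeys ▸ hbT) (not_lt.1 hbx) hba.le)
  exact mem_subtreeKeys_of_between h.hT (BTree.mem_subtreeKeys_self h.hT hbT)
    (mem_subtreeKeys_of_mem_pathSet h.hT h.hs hb) (h.subtreeKeys_subset a hx) hbx.le hxs.le

lemma SubtreeDisjoint.subset {X Y : Finset ℕ} (hY : SubtreeDisjoint T' Y) (h : X ⊆ Y) :
    SubtreeDisjoint T' X :=
  fun a ha b hb => hY a (h ha) b (h hb)

lemma SubtreeDisjoint.notMem (h : IsAccess T s T') {X : Finset ℕ} (hX : X ⊆ pathSet T s)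
    (hd : SubtreeDisjoint T' X) {a b : ℕ} (ha : a ∈ X) (hb : b ∈ X) (hab : a ≠ b) :
    b ∉ subtreeKeys T' a := fun hba => by
  have := Finset.mem_inter.2 ⟨hba, h.mem_subtreeKeys_self (hX hb)⟩
  rw [hd a ha b hb hab] at this
  simp at this

variable {w : ℕ → ℝ}

lemma SubtreeDisjoint.card_le_of_lt (h : IsAccess T s T') (hw : ∀ i ∈ keys T, 0 < w i)
    {X : Finset ℕ} (hX : X ⊆ pathSet T s) (hd : SubtreeDisjoint T' X) (hsX : ∀ x ∈ X, s < x) :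
    (X.card : ℝ) + phiOn w T' X ≤ phiOn w T X + 2 * Real.logb 2 (wsum w (keys T) / w s) :=
  card_add_sum_logb_wsum_le hw h.hs X (fun _ _ => BTree.subtreeKeys_subset _ _)
    (fun a _ => h.subtreeKeys_subset a)
    (fun _ ha => mem_subtreeKeys_of_mem_pathSet h.hT h.hs (hX ha))
    (fun a ha hs => lt_irrefl _ (lt_of_mem_subtreeKeys_of_root_lt h.hT' h.hroot (hsX a ha) hs))
    (fun a ha => ⟨a, h.mem_subtreeKeys_self (hX ha)⟩)
    (fun a ha _ hb hab => Finset.disjoint_iff_inter_eq_empty.2 (hd a ha _ hb hab))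
    (fun a ha _ hb hab => h.subtreeKeys_subset_of_lt (hsX a ha) hab (hX ha) (hX hb)
      (hd.notMem h hX ha hb hab.ne))

lemma SubtreeDisjoint.card_le_of_gt (h : IsAccess T s T') (hw : ∀ i ∈ keys T, 0 < w i)
    {X : Finset ℕ} (hX : X ⊆ pathSet T s) (hd : SubtreeDisjoint T' X) (hsX : ∀ x ∈ X, x < s) :
    (X.card : ℝ) + phiOn w T' X ≤ phiOn w T X + 2 * Real.logb 2 (wsum w (keys T) / w s) :=
  card_add_sum_logb_wsum_le (α := ℕᵒᵈ) (A := fun a => subtreeKeys T a.ofDual)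
    (B := fun a => subtreeKeys T' a.ofDual)
    hw h.hs X (fun _ _ => BTree.subtreeKeys_subset _ _)
    (fun a _ => h.subtreeKeys_subset a)
    (fun _ ha => mem_subtreeKeys_of_mem_pathSet h.hT h.hs (hX ha))
    (fun a ha hs => lt_irrefl _ (lt_of_mem_subtreeKeys_of_lt_root h.hT' h.hroot (hsX a ha) hs))
    (fun a ha => ⟨a, h.mem_subtreeKeys_self (hX ha)⟩)
    (fun a ha _ hb hab => Finset.disjoint_iff_inter_eq_empty.2 (hd a ha _ hb hab))
    (fun a ha _ hb hab => h.subtreeKeys_subset_of_gt (hsX a ha) hab (hX ha) (hX hb)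
      (hd.notMem h hX ha hb hab.ne))

lemma IsAccess.logb_nonneg (h : IsAccess T s T') (hw : ∀ i ∈ keys T, 0 < w i) :
    0 ≤ Real.logb 2 (wsum w (keys T) / w s) :=
  Real.logb_nonneg one_lt_two ((one_le_div (hw s h.hs)).2 (le_wsum h.hs hw))

lemma SubtreeDisjoint.card_le (h : IsAccess T s T') (hw : ∀ i ∈ keys T, 0 < w i)
    {X : Finset ℕ} (hX : X ⊆ pathSet T s) (hd : SubtreeDisjoint T' X) :
    (X.card : ℝ) ≤
      phiOn w T X - phiOn w T' X + 2 + 8 * Real.logb 2 (wsum w (keys T) / w s) := by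
  have hL := h.logb_nonneg hw
  by_cases hs : s ∈ X
  · have hXs : X = {s} := by
      refine Finset.eq_singleton_iff_unique_mem.2 ⟨hs, fun b hb => ?_⟩
      by_contra hbs
      refine hd.notMem h hX hs hb (Ne.symm hbs) ?_
      rw [subtreeKeys_of_root? h.hroot, h.hkeys]
      exact pathSet_subset_keys _ _ (hX hb)
    have hlog := Real.logb_le_logb_of_le one_lt_two (hw s h.hs)
      (le_wsum (BTree.mem_subtreeKeys_self h.hT h.hs)
        fun i hi => hw i (BTree.subtreeKeys_subset _ _ hi))
    rw [Real.logb_div (wsum_pos h.hs hw).ne' (hw s h.hs).ne'] at hL ⊢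
    simp only [hXs, phiOn, Finset.sum_singleton, Finset.card_singleton, Nat.cast_one,
      subtreeKeys_of_root? h.hroot, h.hkeys]
    linarith
  · have hgt := (hd.subset (Finset.filter_subset (s < ·) X)).card_le_of_lt h hw
      ((Finset.filter_subset _ _).trans hX) fun x hx => (Finset.mem_filter.1 hx).2
    have hlt := (hd.subset (Finset.filter_subset (¬ s < ·) X)).card_le_of_gt h hw
      ((Finset.filter_subset _ _).trans hX) fun x hx => by
        obtain ⟨hxX, hx⟩ := Finset.mem_filter.1 hx
        exact lt_of_le_of_ne (not_lt.1 hx) fun hxs => hs (hxs ▸ hxX)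
    have hcard : ((X.filter (s < ·)).card : ℝ) + (X.filter (¬ s < ·)).card = X.card :=
      mod_cast Finset.card_filter_add_card_filter_not (s := X) (s < ·)
    have hphi : ∀ S, phiOn w S (X.filter (s < ·)) + phiOn w S (X.filter (¬ s < ·)) =
        phiOn w S X := fun S => Finset.sum_filter_add_sum_filter_not _ _ _
    have h1 := hphi T
    have h2 := hphi T'
    linarith

lemma IsMonotone.phiOn_le (h : IsAccess T s T') (hw : ∀ i ∈ keys T, 0 < w i)
    {X : Finset ℕ} (hX : X ⊆ pathSet T s) (hm : IsMonotone s T' X) :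
    phiOn w T' X ≤ phiOn w T X + Real.logb 2 (wsum w (keys T) / w s) := by
  rcases hm with ⟨hsX, d, hd⟩ | ⟨hsX, d, hd⟩
  · exact sum_logb_wsum_le hw h.hs X (fun _ _ => BTree.subtreeKeys_subset _ _)
      (fun a _ => h.subtreeKeys_subset a)
      (fun _ ha => mem_subtreeKeys_of_mem_pathSet h.hT h.hs (hX ha))
      (fun a ha => ⟨a, h.mem_subtreeKeys_self (hX ha)⟩)
      (fun a ha b hb hab => h.subtreeKeys_subset_of_lt (hsX a ha) hab (hX ha) (hX hb) fun hba =>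
        (rightDepth_lt_of_mem_subtreeKeys h.hT' hba hab).ne ((hd a ha).trans (hd b hb).symm))
  · exact sum_logb_wsum_le (α := ℕᵒᵈ) (A := fun a => subtreeKeys T a.ofDual)
      (B := fun a => subtreeKeys T' a.ofDual)
      hw h.hs X (fun _ _ => BTree.subtreeKeys_subset _ _)
      (fun a _ => h.subtreeKeys_subset a)
      (fun _ ha => mem_subtreeKeys_of_mem_pathSet h.hT h.hs (hX ha))
      (fun a ha => ⟨a, h.mem_subtreeKeys_self (hX ha)⟩)
      (fun a ha b hb hab => h.subtreeKeys_subset_of_gt (hsX a ha) hab (hX ha) (hX hb) fun hba =>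
        (leftDepth_lt_of_mem_subtreeKeys h.hT' hba hab).ne ((hd a ha).trans (hd b hb).symm))

end Access

end Paper

/-- **Theorem (disjoint + monotone sets).** If the search path `P` is partitioned into `k`
subtree-disjoint sets `D₁,…,D_k` and `ℓ` monotone sets `M₁,…,M_ℓ`, then
`Σᵢ |Dᵢ| ≤ Φ_T(P) − Φ_{T'}(P) + 2k + (8k + ℓ)·log(W / w(s))`. -/
theorem disj_mono_theorem (T : BTree) (s : ℕ) (T' : BTree) (hacc : IsAccess T s T')
    (k ℓ : ℕ) (D : Fin k → Finset ℕ) (M : Fin ℓ → Finset ℕ)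
    (hD : ∀ i, SubtreeDisjoint T' (D i))
    (hM : ∀ j, IsMonotone s T' (M j))
    (hDD : ∀ i j, i ≠ j → Disjoint (D i) (D j))
    (hMM : ∀ i j, i ≠ j → Disjoint (M i) (M j))
    (hDM : ∀ i j, Disjoint (D i) (M j))
    (hcover : Finset.univ.biUnion D ∪ Finset.univ.biUnion M = pathSet T s)
    (w : ℕ → ℝ) (hw : ∀ i ∈ keys T, 0 < w i) :
    ((∑ i, (D i).card : ℕ) : ℝ) ≤
      phiOn w T (pathSet T s) - phiOn w T' (pathSet T s) +
        2 * (k : ℝ) + (8 * (k : ℝ) + (ℓ : ℝ)) * Real.logb 2 (wsum w (keys T) / w s) := by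
  have hDP : ∀ i, D i ⊆ pathSet T s := fun i => hcover ▸
    (Finset.subset_biUnion_of_mem D (Finset.mem_univ i)).trans Finset.subset_union_left
  have hMP : ∀ j, M j ⊆ pathSet T s := fun j => hcover ▸
    (Finset.subset_biUnion_of_mem M (Finset.mem_univ j)).trans Finset.subset_union_right
  have hphi : ∀ S, phiOn w S (pathSet T s) =
      ∑ i, phiOn w S (D i) + ∑ j, phiOn w S (M j) := by
    intro S
    have hdisj : Disjoint (Finset.univ.biUnion D) (Finset.univ.biUnion M) := by
      simp only [Finset.disjoint_biUnion_left, Finset.disjoint_biUnion_right]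
      exact fun i _ j _ => hDM j i
    rw [← hcover, phiOn, Finset.sum_union hdisj,
      Finset.sum_biUnion fun i _ j _ hij => hDD i j hij,
      Finset.sum_biUnion fun i _ j _ hij => hMM i j hij]
    rfl
  have h1 := Finset.sum_le_sum fun i (_ : i ∈ Finset.univ) =>
    (hD i).card_le hacc hw (hDP i)
  have h2 := Finset.sum_le_sum fun j (_ : j ∈ Finset.univ) =>
    (hM j).phiOn_le hacc hw (hMP j)
  simp only [Finset.sum_add_distrib, Finset.sum_sub_distrib, Finset.sum_const, Finset.card_univ,
    Fintype.card_fin, nsmul_eq_mul] at h1 h2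
  rw [hphi T, hphi T']
  push_cast
  linarith
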